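/- arXiv:2010.04439 — 2 statements merged into one kernel-verified Lean document; each statement's English description precedes it below -/
import Mathlib

section
/- Let p be an odd prime and let a, b be integers with gcd(a,p) = gcd(b,p) = 1. Then, computing in ℤ/pℤ, Σ_{n=0}^{p-1} (Σ_{k=0}^{n} C(n,k)·C(2k,k)·(a⁻¹)^k)·(Σ_{k=0}^{n} C(n,k)·C(2k,k)·(b⁻¹)^k) = (-ab/p), where (·/p) is the Legendre symbol. -/
open Finset Polynomial in
/-- Over a finite field with `q` elements, the sum of the values of a polynomial of degree at most
`q - 1` is minus its coefficient of degree `q - 1`. -/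
theorem FiniteField.sum_eval_eq_neg_coeff {K : Type*} [Field K] [Fintype K] (P : K[X])
    (hP : P.natDegree ≤ Fintype.card K - 1) :
    ∑ x : K, P.eval x = -P.coeff (Fintype.card K - 1) := by
  classical
  have hq : Fintype.card K - 1 ≠ 0 := by have := Fintype.one_lt_card (α := K); omega
  have top : ∑ x : K, x ^ (Fintype.card K - 1) = -1 := by
    have h : ∀ x : K, x ^ (Fintype.card K - 1) = 1 - if x = 0 then 1 else 0 := by
      intro x
      split_ifs with hx
      · rw [hx, zero_pow hq, sub_self]
      · rw [FiniteField.pow_card_sub_one_eq_one x hx, sub_zero]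
    simp [h]
  simp_rw [eval_eq_sum_range' (Nat.lt_succ_of_le hP)]
  rw [sum_comm]
  simp_rw [← mul_sum]
  rw [sum_range_succ, top, sum_eq_zero, zero_add, mul_neg_one]
  intro i hi
  rw [FiniteField.sum_pow_lt_card_sub_one K i (mem_range.mp hi), mul_zero]

theorem ZMod.sum_range_natCast {p : ℕ} [NeZero p] {M : Type*} [AddCommMonoid M]
    (f : ZMod p → M) : ∑ n ∈ Finset.range p, f n = ∑ x : ZMod p, f x := by
  refine Finset.sum_bij' (fun n _ => (n : ZMod p)) (fun x _ => x.val) ?_ ?_ ?_ ?_ ?_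
  · simp
  · intro x _
    simpa using ZMod.val_lt x
  · intro n hn
    exact ZMod.val_cast_of_lt (Finset.mem_range.mp hn)
  · simp
  · simp

theorem ZMod.choose_prime_sub_one (p : ℕ) [hp : Fact p.Prime] (k : ℕ) (hk : k < p) :
    ((p - 1).choose k : ZMod p) = (-1) ^ k := by
  induction k with
  | zero => simp
  | succ k ih =>
    have h : (p.choose (k + 1) : ZMod p) = 0 :=
      (ZMod.natCast_eq_zero_iff _ _).mpr (hp.out.dvd_choose_self k.succ_ne_zero hk)
    have h' : p.choose (k + 1) = (p - 1).choose k + (p - 1).choose (k + 1) := by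
      conv_lhs => rw [← Nat.sub_add_cancel hp.out.one_le]
      rw [Nat.choose_succ_succ]
    rw [h', Nat.cast_add, ih (by omega)] at h
    linear_combination h

theorem ZMod.centralBinom_eq_zero {p : ℕ} [hp : Fact p.Prime] {k : ℕ} (hk : k < p)
    (h : p ≤ 2 * k) : ((2 * k).choose k : ZMod p) = 0 :=
  (ZMod.natCast_eq_zero_iff _ _).mpr (hp.out.dvd_choose hk (by omega) h)

theorem ZMod.factorial_ne_zero {p : ℕ} [hp : Fact p.Prime] {k : ℕ} (hk : k < p) :
    (k.factorial : ZMod p) ≠ 0 := by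
  rw [Ne, ZMod.natCast_eq_zero_iff, hp.out.dvd_factorial]
  omega

/-- Orthogonality of binomial coefficients modulo `p`, up to factorials. -/
theorem ZMod.factorial_mul_sum_choose_mul_choose (p : ℕ) [hp : Fact p.Prime] (j k : ℕ)
    (h : j + k ≤ p - 1) :
    (j.factorial : ZMod p) * k.factorial *
        ∑ n ∈ Finset.range p, (n.choose j : ZMod p) * n.choose k =
      if j + k = p - 1 then -1 else 0 := by
  have hd : (descPochhammer (ZMod p) j * descPochhammer (ZMod p) k).natDegree = j + k := by
    rw [(monic_descPochhammer _ j).natDegree_mul (monic_descPochhammer _ k),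
      descPochhammer_natDegree, descPochhammer_natDegree]
  have hsum := FiniteField.sum_eval_eq_neg_coeff
    (descPochhammer (ZMod p) j * descPochhammer (ZMod p) k) (by rw [hd, ZMod.card]; exact h)
  rw [ZMod.card, ← ZMod.sum_range_natCast] at hsum
  have hterm : ∀ n : ℕ, (descPochhammer (ZMod p) j * descPochhammer (ZMod p) k).eval (n : ZMod p) =
      (j.factorial : ZMod p) * k.factorial * ((n.choose j : ZMod p) * n.choose k) := by
    intro n
    rw [Polynomial.eval_mul, descPochhammer_eval_eq_descFactorial,
      descPochhammer_eval_eq_descFactorial, Nat.descFactorial_eq_factorial_mul_choose,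
      Nat.descFactorial_eq_factorial_mul_choose]
    push_cast
    ring
  simp_rw [hterm] at hsum
  rw [Finset.mul_sum, hsum]
  split_ifs with hjk
  · rw [← hjk, ← hd, Polynomial.coeff_natDegree,
      ((monic_descPochhammer _ j).mul (monic_descPochhammer _ k)).leadingCoeff]
  · rw [Polynomial.coeff_eq_zero_of_natDegree_lt (by omega), neg_zero]

/-- For `p = 2 * m + 1`, only the indices `k ≤ m` contribute to the binomial transform of
`k ↦ (2 * k).choose k * x ^ k` modulo `p`. -/
theorem ZMod.sum_choose_mul_centralBinom_eq {p m n : ℕ} [Fact p.Prime] (hm : p = 2 * m + 1)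
    (hn : n < p) (x : ZMod p) :
    ∑ k ∈ Finset.range (n + 1), (n.choose k : ZMod p) * ((2 * k).choose k : ZMod p) * x ^ k =
      ∑ k ∈ Finset.range (m + 1), (n.choose k : ZMod p) * ((2 * k).choose k : ZMod p) * x ^ k := by
  have left : ∑ k ∈ Finset.range (n + 1),
      (n.choose k : ZMod p) * ((2 * k).choose k : ZMod p) * x ^ k =
      ∑ k ∈ Finset.range p, (n.choose k : ZMod p) * ((2 * k).choose k : ZMod p) * x ^ k := by
    refine Finset.sum_subset (Finset.range_subset_range.mpr hn) fun k _ hk => ?_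
    rw [Nat.choose_eq_zero_of_lt (by simpa using hk)]
    simp
  rw [left]
  symm
  refine Finset.sum_subset (Finset.range_subset_range.mpr (by omega)) fun k hk hk' => ?_
  rw [Finset.mem_range] at hk hk'
  rw [ZMod.centralBinom_eq_zero hk (by omega)]
  simp

theorem ZMod.sum_mul_sum_choose_mul_centralBinom {p m : ℕ} [Fact p.Prime] (hm : p = 2 * m + 1)
    (x y : ZMod p) :
    ∑ n ∈ Finset.range p,
        (∑ k ∈ Finset.range (n + 1),
          (n.choose k : ZMod p) * ((2 * k).choose k : ZMod p) * x ^ k) *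
        (∑ k ∈ Finset.range (n + 1),
          (n.choose k : ZMod p) * ((2 * k).choose k : ZMod p) * y ^ k) =
      (-(x * y)) ^ m := by
  set S : ℕ → ℕ → ZMod p := fun j k =>
    ∑ n ∈ Finset.range p, (n.choose j : ZMod p) * n.choose k with hS
  set c : ℕ → ZMod p := fun k => ((2 * k).choose k : ZMod p) with hc
  have expand : ∑ n ∈ Finset.range p,
        (∑ k ∈ Finset.range (n + 1),
          (n.choose k : ZMod p) * ((2 * k).choose k : ZMod p) * x ^ k) *
        (∑ k ∈ Finset.range (n + 1),
          (n.choose k : ZMod p) * ((2 * k).choose k : ZMod p) * y ^ k) =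
      ∑ j ∈ Finset.range (m + 1), ∑ k ∈ Finset.range (m + 1),
        c j * x ^ j * (c k * y ^ k) * S j k := by
    simp only [hS]
    simp_rw [Finset.mul_sum (Finset.range p)]
    rw [Finset.sum_congr rfl fun j _ => Finset.sum_comm, Finset.sum_comm]
    refine Finset.sum_congr rfl fun n hn => ?_
    rw [ZMod.sum_choose_mul_centralBinom_eq hm (Finset.mem_range.mp hn),
      ZMod.sum_choose_mul_centralBinom_eq hm (Finset.mem_range.mp hn), Finset.sum_mul_sum]
    exact Finset.sum_congr rfl fun j _ => Finset.sum_congr rfl fun k _ => by ring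
  have vanish : ∀ j k, j ≤ m → k ≤ m → j + k ≠ 2 * m → S j k = 0 := by
    intro j k hj hk hjk
    have h := ZMod.factorial_mul_sum_choose_mul_choose p j k (by omega)
    rw [if_neg (by omega)] at h
    exact (mul_eq_zero.mp h).resolve_left
      (mul_ne_zero (ZMod.factorial_ne_zero (by omega)) (ZMod.factorial_ne_zero (by omega)))
  have diag := ZMod.factorial_mul_sum_choose_mul_choose p m m (by omega)
  rw [if_pos (by omega)] at diag
  have wilson : c m * m.factorial * m.factorial = -1 := by
    rw [← ZMod.wilsons_lemma p, hc, show p - 1 = m + m by omega,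
      ← Nat.add_choose_mul_factorial_mul_factorial m m, ← two_mul]
    push_cast
    ring
  have middle : c m = (-1) ^ m := by
    rw [← ZMod.choose_prime_sub_one p m (by omega), hc, show p - 1 = 2 * m by omega]
  have sq : c m * c m = 1 := by rw [middle, ← mul_pow]; simp
  have diag' : S m m = c m := by
    linear_combination (-c m) * diag + S m m * wilson
  rw [expand, Finset.sum_eq_single m, Finset.sum_eq_single m, diag', neg_pow, ← middle, mul_pow]
  · linear_combination (x ^ m * y ^ m * c m) * sq
  · intro k hk hkm
    rw [Finset.mem_range] at hk
    rw [vanish m k le_rfl (by omega) (by omega), mul_zero]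
  · simp
  · intro j hj hjm
    refine Finset.sum_eq_zero fun k hk => ?_
    rw [Finset.mem_range] at hj hk
    rw [vanish j k (by omega) (by omega) (by omega), mul_zero]
  · simp

theorem ZMod.intCast_ne_zero_of_gcd_eq_one {p : ℕ} [hp : Fact p.Prime] {a : ℤ}
    (h : Int.gcd a p = 1) : (a : ZMod p) ≠ 0 := by
  rw [Ne, ZMod.intCast_zmod_eq_zero_iff_dvd]
  intro hd
  rw [Int.gcd_eq_natAbs_right hd] at h
  exact hp.out.one_lt.ne' (by simpa using h)

theorem stmt_5 (p : ℕ) [Fact (Nat.Prime p)] (hodd : Odd p)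
    (a b : ℤ) (hap : Int.gcd a p = 1) (hbp : Int.gcd b p = 1) :
    ∑ n ∈ Finset.range p,
        (∑ k ∈ Finset.range (n + 1),
          (n.choose k : ZMod p) * ((2 * k).choose k : ZMod p) * ((a : ZMod p)⁻¹) ^ k) *
        (∑ k ∈ Finset.range (n + 1),
          (n.choose k : ZMod p) * ((2 * k).choose k : ZMod p) * ((b : ZMod p)⁻¹) ^ k) =
      (legendreSym p (-(a * b)) : ZMod p) := by
  obtain ⟨m, hm⟩ := hodd
  rw [ZMod.sum_mul_sum_choose_mul_centralBinom hm, legendreSym.eq_pow,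
    show p / 2 = m by omega, ← mul_inv, ← inv_neg, inv_pow]
  push_cast
  have hne : -((a : ZMod p) * b) ≠ 0 :=
    neg_ne_zero.mpr (mul_ne_zero (ZMod.intCast_ne_zero_of_gcd_eq_one hap)
      (ZMod.intCast_ne_zero_of_gcd_eq_one hbp))
  have hsq := ZMod.pow_card_sub_one_eq_one hne
  rw [show p - 1 = m + m by omega, pow_add] at hsq
  exact inv_eq_of_mul_eq_one_left hsq
end

section
/- Let p > 3 be a prime. Then, computing in ℤ/pℤ, Σ_{n=0}^{p-1} (Σ_{k=0}^{n} C(n,k)·C_k·((-6)⁻¹)^k)² = 4·(-1/p) + 2·(3/p) − 5, where (·/p) is the Legendre symbol. -/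
open Polynomial Finset

variable {p : ℕ} [Fact p.Prime] {h : ℕ}

theorem ZMod.sum_pow_eq_ite (i : ℕ) :
    ∑ t : ZMod p, t ^ i = if i ≠ 0 ∧ p - 1 ∣ i then -1 else 0 := by
  rcases eq_or_ne i 0 with rfl | hi
  · simp
  · have key := FiniteField.sum_pow_units (ZMod p) i
    rw [ZMod.card] at key
    simp only [ne_eq, hi, not_false_eq_true, true_and]
    rw [← key, ← Finset.sum_subset (Finset.subset_univ (univ \ {0}))]
    · symm
      refine Finset.sum_bij (fun u _ => (u : ZMod p)) (by simp) (by simp [Units.ext_iff]) ?_ (by simp)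
      intro b hb
      exact ⟨Units.mk0 b (by simpa using hb), by simp⟩
    · intro x _ hx
      have : x = 0 := by simpa using hx
      simp [this, hi]

theorem ZMod.sum_eval_eq (hp : p = 2 * h + 1) (hh : 2 ≤ h) (G : (ZMod p)[X])
    (hG : G.natDegree < 6 * h) :
    ∑ t : ZMod p, G.eval t = -(G.coeff (2 * h) + G.coeff (4 * h)) := by
  simp_rw [eval_eq_sum_range' hG]
  rw [Finset.sum_comm]
  simp_rw [← Finset.mul_sum, ZMod.sum_pow_eq_ite]
  have hs : ∀ i ∈ range (6 * h), G.coeff i * (if i ≠ 0 ∧ p - 1 ∣ i then (-1 : ZMod p) else 0) =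
      (if i = 2 * h then -G.coeff i else 0) + (if i = 4 * h then -G.coeff i else 0) := by
    intro i hi
    rw [Finset.mem_range] at hi
    have hiff : (i ≠ 0 ∧ p - 1 ∣ i) ↔ (i = 2 * h ∨ i = 4 * h) := by
      rw [hp, Nat.add_sub_cancel]
      constructor
      · rintro ⟨h0, c, rfl⟩
        have hc : c < 3 := by nlinarith
        interval_cases c <;> omega
      · rintro (rfl | rfl)
        · exact ⟨by omega, dvd_rfl⟩
        · exact ⟨by omega, 2, by ring⟩
    simp only [hiff]
    split_ifs <;> first | omega | simp
  rw [Finset.sum_congr rfl hs, Finset.sum_add_distrib]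
  simp only [Finset.sum_ite_eq', Finset.mem_range]
  rw [if_pos (by omega), if_pos (by omega)]
  ring

theorem ZMod.two_mul_half_add_one (hp : p = 2 * h + 1) : (2 * h + 1 : ZMod p) = 0 := by
  have : ((2 * h + 1 : ℕ) : ZMod p) = 0 := (ZMod.natCast_eq_zero_iff _ _).2 (by rw [hp])
  exact_mod_cast this

theorem ZMod.pow_two_mul_half (hp : p = 2 * h + 1) {a : ZMod p} (ha : a ≠ 0) :
    a ^ (2 * h) = 1 := by
  have := ZMod.pow_card_sub_one_eq_one ha
  rwa [show p - 1 = 2 * h by omega] at this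

theorem ZMod.pow_two_mul_half_sub_one (hp : p = 2 * h + 1) (hh : 1 ≤ h) {a : ZMod p}
    (ha : a ≠ 0) : a ^ (2 * h - 1) = a⁻¹ := by
  apply eq_inv_of_mul_eq_one_left
  rw [← pow_succ, show 2 * h - 1 + 1 = 2 * h by omega, ZMod.pow_two_mul_half hp ha]

theorem two_mul_catalan_eq_choose (hp : p = 2 * h + 1) (k : ℕ) (hk : k + 1 < p) :
    2 * (catalan k : ZMod p) = -(-4) ^ (k + 1) * ((h + 1).choose (k + 1) : ZMod p) := by
  have h0 := ZMod.two_mul_half_add_one hp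
  induction k with
  | zero => simp; linear_combination (-2) * h0
  | succ k ih =>
    have ih := ih (by omega)
    have hne : ((k + 2 : ℕ) : ZMod p) ≠ 0 := by
      rw [Ne, ZMod.natCast_eq_zero_iff]
      exact fun hd => absurd (Nat.le_of_dvd (by omega) hd) (by omega)
    have hrec : (k + 2) * catalan (k + 1) = 2 * (2 * k + 1) * catalan k := by
      have h1 := succ_mul_catalan_eq_centralBinom k
      have h2 := succ_mul_catalan_eq_centralBinom (k + 1)
      have h3 := Nat.succ_mul_centralBinom_succ k
      apply Nat.eq_of_mul_eq_mul_left (Nat.succ_pos k)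
      calc (k + 1) * ((k + 2) * catalan (k + 1)) = (k + 1) * Nat.centralBinom (k + 1) := by
            rw [← h2]
        _ = _ := by rw [h3, ← h1, Nat.succ_eq_add_one]; ring
    have hch : ((h + 1).choose (k + 2) : ZMod p) * (k + 2) =
        (h + 1).choose (k + 1) * (h - k) := by
      rcases le_or_gt k h with hkh | hkh
      · have := Nat.choose_succ_right_eq (h + 1) (k + 1)
        rw [show h + 1 - (k + 1) = h - k by omega] at this
        have := congrArg (Nat.cast : ℕ → ZMod p) this
        push_cast [Nat.cast_sub hkh] at this
        linear_combination this
      · rw [Nat.choose_eq_zero_of_lt (by omega : h + 1 < k + 2),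
          Nat.choose_eq_zero_of_lt (by omega : h + 1 < k + 1)]
        simp
    have hrec' := congrArg (Nat.cast : ℕ → ZMod p) hrec
    push_cast at hrec' hne
    apply mul_left_cancel₀ hne
    rw [show k + 1 + 1 = k + 2 by ring]
    linear_combination 2 * hrec' + (2 * (2 * k + 1)) * ih + (-4) ^ (k + 2) * hch
      - (-4) ^ (k + 1) * 2 * ((h + 1).choose (k + 1) : ZMod p) * h0

theorem catalan_prime_sub_one (hp3 : 3 < p) : (catalan (p - 1) : ZMod p) = -1 := by
  obtain ⟨n, hn⟩ : ∃ n, p = n + 1 := ⟨p - 1, by omega⟩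
  have h1 := succ_mul_catalan_eq_centralBinom n
  have h2 := Nat.choose_succ_right_eq (2 * n) n
  rw [← Nat.centralBinom_eq_two_mul_choose, show 2 * n - n = n by omega] at h2
  have h3 : catalan n + (2 * n).choose (n + 1) = Nat.centralBinom n := by
    apply Nat.eq_of_mul_eq_mul_left (Nat.succ_pos n)
    rw [Nat.succ_eq_add_one]
    linear_combination h1 + h2
  have h4 : ((2 * n).choose (n + 1) : ZMod p) = 1 := by
    have := Choose.choose_modEq_choose_mod_mul_choose_div_nat (n := 2 * n) (k := p) (p := p)
    rw [Nat.mod_self, Nat.div_self (by omega),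
      show 2 * n / p = 1 from Nat.div_eq_of_lt_le (by omega) (by omega)] at this
    simpa [← hn] using (ZMod.natCast_eq_natCast_iff _ _ _).2 this
  have h5 : ((n + 1 : ℕ) : ZMod p) = 0 := by rw [← hn]; exact ZMod.natCast_self p
  have h1' := congrArg (Nat.cast : ℕ → ZMod p) h1
  have h3' := congrArg (Nat.cast : ℕ → ZMod p) h3
  push_cast at h1' h3' h5
  rw [show p - 1 = n by omega]
  linear_combination h3' - h1' - h4 + (catalan n : ZMod p) * h5

theorem two_mul_catalan_eq_sum (hp : p = 2 * h + 1) (hh : 2 ≤ h) (k : ℕ) (hk : k < p) :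
    2 * (catalan k : ZMod p) =
      ∑ u : ZMod p, (4 - u) * (1 - (u * (u - 4)) ^ h) * u ^ k := by
  have hev : ∀ u : ZMod p, (4 - u) * (1 - (u * (u - 4)) ^ h) * u ^ k =
      (C 4 * X ^ k - X ^ (k + 1) + X ^ (k + h) * (X + C (-4)) ^ (h + 1) : (ZMod p)[X]).eval u := by
    intro u
    simp only [eval_add, eval_sub, eval_mul, eval_pow, eval_X, eval_C, mul_pow]
    ring
  simp_rw [hev]
  rw [ZMod.sum_eval_eq hp hh]
  · simp only [coeff_add, coeff_sub, coeff_C_mul, coeff_X_pow, coeff_X_pow_mul',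
      coeff_X_add_C_pow]
    have h4a : ¬ 4 * h = k := by omega
    have h4b : ¬ 4 * h = k + 1 := by omega
    have h4c : k + h ≤ 4 * h := by omega
    have h0 := ZMod.two_mul_half_add_one hp
    rw [if_neg h4a, if_neg h4b, if_pos h4c]
    rcases Nat.lt_or_ge (k + 1) p with hk1 | hk1
    · rw [two_mul_catalan_eq_choose hp k hk1, if_neg (by omega)]
      rcases Nat.lt_or_ge (k + 1) (2 * h) with hk2 | hk2
      · rw [if_neg (by omega), Nat.choose_eq_zero_of_lt (by omega : h + 1 < 4 * h - (k + h))]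
        split_ifs with hkh
        · rw [show 2 * h - (k + h) = h - k by omega, show h + 1 - (h - k) = k + 1 by omega,
            show h - k = h + 1 - (k + 1) by omega, Nat.choose_symm (by omega)]
          simp
        · rw [Nat.choose_eq_zero_of_lt (by omega : h + 1 < k + 1)]
          simp
      · rw [if_pos (by omega), if_neg (by omega), show 4 * h - (k + h) = h + 1 by omega,
          Nat.choose_eq_zero_of_lt (by omega : h + 1 < k + 1)]
        simp
    · obtain rfl : k = p - 1 := by omega
      rw [catalan_prime_sub_one (by omega), if_pos (by omega), if_neg (by omega),
        if_neg (by omega), show 4 * h - (p - 1 + h) = h by omega, Nat.choose_succ_self_right]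
      simp
      linear_combination (-2) * h0
  · refine lt_of_le_of_lt (b := 4 * h + 1) ?_ (by omega)
    compute_degree
    omega

section QuadraticSums

variable (α β γ : ZMod p)

theorem natDegree_quadratic_pow_le (h : ℕ) :
    ((C α + C β * X + C γ * X ^ 2 : (ZMod p)[X]) ^ h).natDegree ≤ 2 * h := by
  rw [mul_comm 2 h]
  exact natDegree_pow_le_of_le h (by compute_degree)

theorem sum_pow_mul_quadratic_pow_middle (hp : p = 2 * h + 1) (hh : 2 ≤ h) :
    ∑ t : ZMod p, t ^ (2 * h) * (α + β * t + γ * t ^ 2) ^ h = -(α ^ h + γ ^ h) := by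
  have hev : ∀ t : ZMod p, t ^ (2 * h) * (α + β * t + γ * t ^ 2) ^ h =
      (X ^ (2 * h) * (C α + C β * X + C γ * X ^ 2) ^ h : (ZMod p)[X]).eval t := by
    simp
  simp_rw [hev]
  rw [ZMod.sum_eval_eq hp hh]
  · rw [coeff_X_pow_mul', coeff_X_pow_mul', if_pos le_rfl, if_pos (by omega), Nat.sub_self,
      show 4 * h - 2 * h = h * 2 by omega, coeff_pow_of_natDegree_le (by compute_degree),
      coeff_zero_eq_eval_zero]
    simp
  · refine lt_of_le_of_lt (natDegree_mul_le.trans (add_le_add (natDegree_X_pow_le _)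
      (natDegree_quadratic_pow_le α β γ h))) (by omega)

theorem sum_pow_mul_quadratic_pow_low (hp : p = 2 * h + 1) (hh : 2 ≤ h) :
    ∑ t : ZMod p, t ^ (2 * h - 1) * (α + β * t + γ * t ^ 2) ^ h =
      -(h * β * α ^ (h - 1)) := by
  have hev : ∀ t : ZMod p, t ^ (2 * h - 1) * (α + β * t + γ * t ^ 2) ^ h =
      (X ^ (2 * h - 1) * (C α + C β * X + C γ * X ^ 2) ^ h : (ZMod p)[X]).eval t := by
    simp
  have hdeg := natDegree_quadratic_pow_le α β γ h
  simp_rw [hev]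
  rw [ZMod.sum_eval_eq hp hh]
  · rw [coeff_X_pow_mul', coeff_X_pow_mul', if_pos (by omega), if_pos (by omega),
      show 2 * h - (2 * h - 1) = 0 + 1 by omega,
      coeff_eq_zero_of_natDegree_lt (n := 4 * h - (2 * h - 1)) (by omega)]
    have hc := coeff_derivative ((C α + C β * X + C γ * X ^ 2 : (ZMod p)[X]) ^ h) 0
    rw [Nat.cast_zero, zero_add (1 : ZMod p), mul_one] at hc
    rw [← hc, coeff_zero_eq_eval_zero, derivative_pow]
    simp
    ring
  · exact lt_of_le_of_lt (natDegree_mul_le.trans (add_le_add (natDegree_X_pow_le _) hdeg))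
      (by omega)

theorem sum_pow_mul_quadratic_pow_high (hp : p = 2 * h + 1) (hh : 2 ≤ h) :
    ∑ t : ZMod p, t ^ (2 * h + 1) * (α + β * t + γ * t ^ 2) ^ h =
      -(h * β * γ ^ (h - 1)) := by
  rw [← sum_pow_mul_quadratic_pow_low γ β α hp hh]
  refine Fintype.sum_equiv (Equiv.inv _) _ _ fun t => ?_
  rcases eq_or_ne t 0 with rfl | ht
  · simp [show 2 * h - 1 ≠ 0 by omega]
  · have h1 := ZMod.pow_two_mul_half hp ht
    have h2 : t⁻¹ ^ (2 * h - 1) = t := by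
      rw [inv_pow, ZMod.pow_two_mul_half_sub_one hp (by omega) ht, inv_inv]
    have h3 : α + β * t + γ * t ^ 2 = t ^ 2 * (γ + β * t⁻¹ + α * t⁻¹ ^ 2) := by
      field_simp
      ring
    rw [Equiv.inv_apply, h2, h3, mul_pow, ← pow_mul, pow_succ, h1]
    ring

theorem sum_mul_quadratic_pow (hp : p = 2 * h + 1) (hh : 2 ≤ h) :
    ∑ t : ZMod p, (1 - 3 * t) * (t - 3) * t ^ (2 * h - 1) * (α + β * t + γ * t ^ 2) ^ h =
      3 * (h * β * α ^ (h - 1)) - 10 * (α ^ h + γ ^ h) + 3 * (h * β * γ ^ (h - 1)) := by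
  have hs : ∀ t : ZMod p,
      (1 - 3 * t) * (t - 3) * t ^ (2 * h - 1) * (α + β * t + γ * t ^ 2) ^ h =
        (-3) * (t ^ (2 * h - 1) * (α + β * t + γ * t ^ 2) ^ h)
        + 10 * (t ^ (2 * h) * (α + β * t + γ * t ^ 2) ^ h)
        + (-3) * (t ^ (2 * h + 1) * (α + β * t + γ * t ^ 2) ^ h) := by
    intro t
    obtain ⟨m, hm⟩ : ∃ m, 2 * h = m + 1 := ⟨2 * h - 1, by omega⟩
    rw [hm, Nat.add_sub_cancel]
    ring
  simp_rw [hs, Finset.sum_add_distrib, ← Finset.mul_sum]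
  rw [sum_pow_mul_quadratic_pow_low α β γ hp hh, sum_pow_mul_quadratic_pow_middle α β γ hp hh,
    sum_pow_mul_quadratic_pow_high α β γ hp hh]
  ring

end QuadraticSums

/-- The weight on `ZMod p` whose moments are the binomial transforms of the Catalan numbers
at `-1 / 6`. -/
def catalanWeight (h : ℕ) (t : ZMod p) : ZMod p :=
  (1 - 3 * t) * (1 - (12 * (1 - t) * (1 - 3 * t)) ^ h)

theorem ZMod.natCast_ne_zero_of_lt {n : ℕ} (h0 : 0 < n) (hn : n < p) : (n : ZMod p) ≠ 0 := by
  rw [Ne, ZMod.natCast_eq_zero_iff]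
  exact fun hd => absurd (Nat.le_of_dvd h0 hd) (by omega)

theorem ZMod.two_ne_zero_of_lt (hp3 : 3 < p) : (2 : ZMod p) ≠ 0 :=
  ZMod.natCast_ne_zero_of_lt (n := 2) (by omega) (by omega)

theorem ZMod.three_ne_zero_of_lt (hp3 : 3 < p) : (3 : ZMod p) ≠ 0 :=
  ZMod.natCast_ne_zero_of_lt (n := 3) (by omega) (by omega)

theorem ZMod.six_ne_zero_of_lt (hp3 : 3 < p) : (6 : ZMod p) ≠ 0 := by
  rw [show (6 : ZMod p) = 2 * 3 by norm_num]
  exact mul_ne_zero (ZMod.two_ne_zero_of_lt hp3) (ZMod.three_ne_zero_of_lt hp3)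

theorem sum_choose_mul_catalan_eq_neg_sum (hp : p = 2 * h + 1) (hh : 2 ≤ h) (n : ℕ) (hn : n < p) :
    ∑ k ∈ Finset.range (n + 1),
        (n.choose k : ZMod p) * (catalan k : ZMod p) * ((-6 : ZMod p)⁻¹) ^ k =
      -∑ t : ZMod p, catalanWeight h t * t ^ n := by
  have h2 : (2 : ZMod p) ≠ 0 := ZMod.two_ne_zero_of_lt (by omega)
  have h6 : (6 : ZMod p) ≠ 0 := ZMod.six_ne_zero_of_lt (by omega)
  apply mul_left_cancel₀ h2
  calc _ = ∑ k ∈ Finset.range (n + 1), ∑ u : ZMod p,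
        (4 - u) * (1 - (u * (u - 4)) ^ h) * (((-6)⁻¹ * u) ^ k * (n.choose k : ZMod p)) := by
        rw [Finset.mul_sum]
        refine Finset.sum_congr rfl fun k hk => ?_
        rw [Finset.mem_range] at hk
        calc _ = (n.choose k : ZMod p) * ((-6)⁻¹) ^ k * (2 * (catalan k : ZMod p)) := by ring
          _ = _ := by
            rw [two_mul_catalan_eq_sum hp hh k (by omega), Finset.mul_sum]
            refine Finset.sum_congr rfl fun u _ => ?_
            rw [mul_pow]
            ring
    _ = ∑ u : ZMod p, (4 - u) * (1 - (u * (u - 4)) ^ h) * ((-6)⁻¹ * u + 1) ^ n := by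
        rw [Finset.sum_comm]
        refine Finset.sum_congr rfl fun u _ => ?_
        rw [← Finset.mul_sum, add_pow]
        simp
    _ = ∑ t : ZMod p, -2 * (catalanWeight h t * t ^ n) := by
        symm
        refine Fintype.sum_equiv ((Equiv.mulLeft₀ 6 h6).trans (Equiv.subLeft 6)) _ _ fun t => ?_
        have e : (-6 : ZMod p)⁻¹ * (6 - 6 * t) + 1 = t := by
          rw [inv_neg]
          field_simp
          ring
        simp only [Equiv.trans_apply, Equiv.mulLeft₀_apply, Equiv.subLeft_apply]
        rw [e, catalanWeight,
          show (6 - 6 * t) * (6 - 6 * t - 4) = 12 * (1 - t) * (1 - 3 * t) by ring]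
        ring
    _ = _ := by
        rw [← Finset.mul_sum]
        ring

theorem ZMod.sum_range_pow_eq (w : ZMod p) :
    ∑ n ∈ Finset.range p, w ^ n = 1 - if w = 1 then 1 else 0 := by
  split_ifs with hw
  · simp [hw]
  · rw [geom_sum_eq hw, ZMod.pow_card, div_self (sub_ne_zero.2 hw), sub_zero]

theorem sum_sq_sum_mul_pow (f : ZMod p → ZMod p) :
    ∑ n ∈ Finset.range p, (-∑ t, f t * t ^ n) ^ 2 =
      (∑ t, f t) ^ 2 - ∑ t, f t * ∑ s, if t * s = 1 then f s else 0 := by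
  calc _ = ∑ n ∈ Finset.range p, ∑ t, ∑ s, f t * (f s * (t * s) ^ n) := by
        refine Finset.sum_congr rfl fun n _ => ?_
        rw [neg_sq, sq, Finset.sum_mul_sum]
        refine Finset.sum_congr rfl fun t _ => Finset.sum_congr rfl fun s _ => ?_
        rw [mul_pow]
        ring
    _ = ∑ t, ∑ s, (f t * f s - f t * if t * s = 1 then f s else 0) := by
        rw [Finset.sum_comm]
        refine Finset.sum_congr rfl fun t _ => ?_
        rw [Finset.sum_comm]
        refine Finset.sum_congr rfl fun s _ => ?_
        rw [← Finset.mul_sum, ← Finset.mul_sum, ZMod.sum_range_pow_eq]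
        split_ifs <;> ring
    _ = _ := by
        simp_rw [Finset.sum_sub_distrib, ← Finset.mul_sum]
        rw [sq, Finset.sum_mul]

theorem sum_ite_catalanWeight (hp : p = 2 * h + 1) (hh : 2 ≤ h) (t : ZMod p) :
    (∑ s : ZMod p, if t * s = 1 then catalanWeight h s else 0) =
      t ^ (2 * h - 1) * (t - 3) * (1 - (12 * (1 - t) * (3 - t)) ^ h) := by
  rcases eq_or_ne t 0 with rfl | ht
  · simp [show 2 * h - 1 ≠ 0 by omega]
  · have h1 := ZMod.pow_two_mul_half hp ht
    have h2 := ZMod.pow_two_mul_half_sub_one hp (by omega) ht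
    have h3 : 12 * (1 - t) * (3 - t) = t ^ 2 * (12 * (1 - t⁻¹) * (1 - 3 * t⁻¹)) := by
      field_simp
      ring
    have hs : ∀ s : ZMod p, t * s = 1 ↔ s = t⁻¹ := fun s => by
      rw [mul_comm, mul_eq_one_iff_eq_inv₀ ht]
    simp only [hs, Finset.sum_ite_eq', Finset.mem_univ, if_true]
    rw [catalanWeight, h3, mul_pow (t ^ 2), ← pow_mul, h1, h2]
    field_simp

theorem sum_catalanWeight_mul (hp : p = 2 * h + 1) (hh : 2 ≤ h) :
    (∑ t : ZMod p, catalanWeight h t * ∑ s, if t * s = 1 then catalanWeight h s else 0) =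
      6 - 2 * 3 ^ h - 4 * (-1) ^ h := by
  have h0 := ZMod.two_mul_half_add_one hp
  have hpow : ∀ a : ZMod p, a ^ (2 * h) = 1 - if a = 0 then 1 else 0 := by
    intro a
    split_ifs with ha
    · simp [ha, show h ≠ 0 by omega]
    · rw [ZMod.pow_two_mul_half hp ha, sub_zero]
  have h2 := ZMod.pow_two_mul_half hp (ZMod.two_ne_zero_of_lt (by omega))
  have h3 := ZMod.pow_two_mul_half hp (ZMod.three_ne_zero_of_lt (by omega))
  have e4 : (4 : ZMod p) ^ h = 1 := by
    rw [← h2, pow_mul]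
    norm_num
  have e12 : (12 : ZMod p) ^ h = 3 ^ h := by
    rw [show (12 : ZMod p) = 4 * 3 by norm_num, mul_pow, e4, one_mul]
  have e36 : (36 : ZMod p) ^ h = 1 := by
    rw [show (36 : ZMod p) = 4 * 3 ^ 2 by norm_num, mul_pow, e4, ← pow_mul, h3, one_mul]
  have e144 : (144 : ZMod p) ^ h = 1 := by
    rw [show (144 : ZMod p) = 4 * 36 by norm_num, mul_pow, e4, e36, one_mul]
  have em4 : (-4 : ZMod p) ^ h = (-1) ^ h := by
    rw [show (-4 : ZMod p) = 4 * (-1) by norm_num, mul_pow, e4, one_mul]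
  have hpt : ∀ t : ZMod p,
      (catalanWeight h t * ∑ s, if t * s = 1 then catalanWeight h s else 0) =
        (1 - 3 * t) * (t - 3) * t ^ (2 * h - 1) * (1 + 0 * t + 0 * t ^ 2) ^ h
        - (1 - 3 * t) * (t - 3) * t ^ (2 * h - 1) * (12 + (-48) * t + 36 * t ^ 2) ^ h
        - (1 - 3 * t) * (t - 3) * t ^ (2 * h - 1) * (36 + (-48) * t + 12 * t ^ 2) ^ h
        + (1 - 3 * t) * (t - 3) * t ^ (2 * h - 1) * (3 + (-10) * t + 3 * t ^ 2) ^ h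
        - if t = 1 then 4 * (-1) ^ h else 0 := by
    intro t
    have hprod : (12 + (-48) * t + 36 * t ^ 2) ^ h * (36 + (-48) * t + 12 * t ^ 2) ^ h =
        (1 - t) ^ (2 * h) * (3 + (-10) * t + 3 * t ^ 2) ^ h := by
      rw [← mul_pow, show (12 + (-48) * t + 36 * t ^ 2) * (36 + (-48) * t + 12 * t ^ 2) =
        144 * ((1 - t) ^ 2 * (3 + (-10) * t + 3 * t ^ 2)) by ring, mul_pow, e144, one_mul,
        mul_pow, ← pow_mul]
    rw [sum_ite_catalanWeight hp hh, catalanWeight,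
      show 12 * (1 - t) * (1 - 3 * t) = 12 + (-48) * t + 36 * t ^ 2 by ring,
      show 12 * (1 - t) * (3 - t) = 36 + (-48) * t + 12 * t ^ 2 by ring,
      show 1 + 0 * t + 0 * t ^ 2 = 1 by ring, one_pow]
    simp only [hpow, sub_eq_zero] at hprod
    rcases eq_or_ne t 1 with rfl | ht
    · rw [if_pos rfl] at hprod ⊢
      have e : (3 + (-10) * 1 + 3 * 1 ^ 2 : ZMod p) ^ h = (-1) ^ h := by
        rw [← em4]
        norm_num
      rw [e] at hprod ⊢
      rw [one_pow]
      linear_combination 4 * hprod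
    · rw [if_neg (Ne.symm ht)] at hprod
      rw [if_neg ht]
      linear_combination (1 - 3 * t) * (t - 3) * t ^ (2 * h - 1) * hprod
  have hsucc : ∀ a : ZMod p, a * a ^ (h - 1) = a ^ h := fun a => by
    rw [← pow_succ', show h - 1 + 1 = h by omega]
  have s12 := hsucc 12
  have s36 := hsucc 36
  have s3 := hsucc 3
  rw [e12] at s12
  rw [e36] at s36
  simp_rw [hpt, Finset.sum_sub_distrib, Finset.sum_add_distrib, Finset.sum_sub_distrib,
    sum_mul_quadratic_pow _ _ _ hp hh]
  simp only [Finset.sum_ite_eq', Finset.mem_univ, if_true, e12, e36, one_pow,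
    zero_pow (show h ≠ 0 by omega)]
  linear_combination 24 * (h : ZMod p) * s12 + 8 * (h : ZMod p) * s36
    - 20 * (h : ZMod p) * s3 + (4 + 2 * 3 ^ h) * h0

theorem stmt_13 (p : ℕ) [Fact (Nat.Prime p)] (hp3 : 3 < p) :
    ∑ n ∈ Finset.range p,
        (∑ k ∈ Finset.range (n + 1),
          (n.choose k : ZMod p) * (catalan k : ZMod p) * ((-6 : ZMod p)⁻¹) ^ k) ^ 2 =
      4 * (legendreSym p (-1) : ZMod p) + 2 * (legendreSym p 3 : ZMod p) - 5 := by
  obtain ⟨h, hp⟩ : ∃ h, p = 2 * h + 1 :=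
    (Fact.out : p.Prime).odd_of_ne_two (by omega)
  have hh : 2 ≤ h := by omega
  have hsum : ∑ t : ZMod p, catalanWeight h t = -1 := by
    have := sum_choose_mul_catalan_eq_neg_sum hp hh 0 (by omega)
    simp at this
    linear_combination this
  rw [Finset.sum_congr rfl fun n hn => by
      rw [sum_choose_mul_catalan_eq_neg_sum hp hh n (Finset.mem_range.1 hn)],
    sum_sq_sum_mul_pow, hsum, sum_catalanWeight_mul hp hh, legendreSym.eq_pow,
    legendreSym.eq_pow, show p / 2 = h by omega]
  push_cast
  ring
end
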